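/- arXiv:math/9701211 — 5 statements merged into one kernel-verified Lean document; each statement's English description precedes it below -/
import Mathlib

section
/- Let θ ∈ (0,π) and set x = cos θ + (sin θ)·i ∈ Sp(1). If y and y' are quaternions of norm 1 with Re y = Re y' and Re(x·y) = Re(x·y'), then there exists a complex quaternion c of norm 1 such that y' = c·y·c⁻¹. -/
open Quaternion

/-- Complex numbers of equal norm differ by the square of a complex number of norm `1`. -/
theorem Complex.exists_norm_eq_one_sq_mul_eq {z w : ℂ} (h : ‖z‖ = ‖w‖) :
    ∃ c : ℂ, ‖c‖ = 1 ∧ c ^ 2 * z = w := by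
  by_cases hz : z = 0
  · refine ⟨1, norm_one, ?_⟩
    have hw : w = 0 := by rw [← norm_eq_zero, ← h, hz, norm_zero]
    simp [hz, hw]
  · obtain ⟨c, hc⟩ := IsAlgClosed.exists_pow_nat_eq (w / z) two_pos
    refine ⟨c, ?_, by rw [hc, div_mul_cancel₀ _ hz]⟩
    have hn : ‖c‖ ^ 2 = 1 := by
      rw [← norm_pow, hc, norm_div, h, div_self (h ▸ norm_ne_zero_iff.mpr hz)]
    exact (pow_eq_one_iff_of_nonneg (norm_nonneg c) two_ne_zero).mp hn

/-- Quaternions of equal norm with the same complex part are conjugate by a complex unit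
quaternion. -/
theorem Quaternion.exists_complex_conj_eq {y y' : ℍ[ℝ]} (hn : ‖y‖ = ‖y'‖)
    (hre : y.re = y'.re) (him : y.imI = y'.imI) :
    ∃ c : ℍ[ℝ], ‖c‖ = 1 ∧ c.imJ = 0 ∧ c.imK = 0 ∧ y' = c * y * c⁻¹ := by
  have hsq : normSq y = normSq y' := by simp only [normSq_eq_norm_mul_self, hn]
  rw [normSq_def', normSq_def', hre, him] at hsq
  have hz : ‖(⟨y.imJ, y.imK⟩ : ℂ)‖ = ‖(⟨y'.imJ, y'.imK⟩ : ℂ)‖ := by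
    rw [← sq_eq_sq₀ (norm_nonneg _) (norm_nonneg _), ← Complex.normSq_eq_norm_sq,
      ← Complex.normSq_eq_norm_sq, Complex.normSq_mk, Complex.normSq_mk]
    linarith
  obtain ⟨c, hc, hcz⟩ := Complex.exists_norm_eq_one_sq_mul_eq hz
  have hc' : c.re * c.re + c.im * c.im = 1 := by
    rw [← Complex.normSq_apply, Complex.normSq_eq_norm_sq, hc, one_pow]
  have hJ := congrArg Complex.re hcz
  have hK := congrArg Complex.im hcz
  simp only [pow_two, Complex.mul_re, Complex.mul_im] at hJ hK
  have hnorm : ‖(c : ℍ[ℝ])‖ = 1 := by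
    rw [← sq_eq_sq₀ (norm_nonneg _) zero_le_one, pow_two, ← normSq_eq_norm_mul_self, normSq_def']
    simp only [re_coeComplex, imI_coeComplex, imJ_coeComplex, imK_coeComplex]
    linarith
  refine ⟨c, hnorm, imJ_coeComplex c, imK_coeComplex c, ?_⟩
  rw [eq_mul_inv_iff_mul_eq₀ (norm_ne_zero_iff.mp (hnorm ▸ one_ne_zero))]
  ext
  · simp [hre, him]; ring
  · simp [hre, him]; ring
  · simp
    linear_combination (-c.re) * hJ - c.im * hK + (c.re * y.imJ - c.im * y.imK) * hc'
  · simp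
    linear_combination c.im * hJ - c.re * hK + (c.re * y.imK + c.im * y.imJ) * hc'

/-- Let `θ ∈ (0,π)` and `x = cos θ + (sin θ)·i` a unit quaternion.
If `y, y'` are unit quaternions with `Re y = Re y'` and `Re (x·y) = Re (x·y')`, then
`y'` is conjugate to `y` by a *complex* unit quaternion `c` (i.e. one with vanishing
`j`- and `k`-parts). -/
theorem stmt_0 (θ : ℝ) (hθ : θ ∈ Set.Ioo 0 Real.pi)
    (x y y' : ℍ[ℝ])
    (hx : x = ⟨Real.cos θ, Real.sin θ, 0, 0⟩)
    (hy : ‖y‖ = 1) (hy' : ‖y'‖ = 1)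
    (hre : y.re = y'.re)
    (hre' : (x * y).re = (x * y').re) :
    ∃ c : ℍ[ℝ], ‖c‖ = 1 ∧ c.imJ = 0 ∧ c.imK = 0 ∧ y' = c * y * c⁻¹ := by
  have hs : Real.sin θ ≠ 0 := (Real.sin_pos_of_mem_Ioo hθ).ne'
  refine Quaternion.exists_complex_conj_eq (hy.trans hy'.symm) hre (mul_left_cancel₀ hs ?_)
  rw [re_mul, re_mul, hre, hx] at hre'
  dsimp only at hre'
  linarith
end

section
/- Let α and β be irreducible homomorphisms from G(p,q,r) to Sp(1) such that (1) α(h) = β(h) and α(x) = β(x), with α(x) a complex quaternion, (2) Re α(y) = Re β(y), and (3) Re(α(x)·α(y)) = Re(β(x)·β(y)). Then α and β are conjugate; moreover, the conjugating element may be chosen to be a complex quaternion c of norm 1, i.e. β(t) = c·α(t)·c⁻¹ for all t ∈ G(p,q,r). -/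
open Quaternion

/-- `Sp(1)`: the multiplicative group of unit quaternions, identified with `SU(2)`. -/
noncomputable abbrev Sp1 : Type := Metric.sphere (0 : ℍ[ℝ]) 1

/-- Relators of the presentation
`⟨x, y, z, h | h central, x^p = h^{-b₁}, y^q = h^{-b₂}, z^r = h^{-b₃}, xyz = h^{-b}⟩`,
with the generators `x, y, z, h` encoded as `0, 1, 2, 3 : Fin 4`. -/
def brieskornRels (p q r : ℕ) (b b₁ b₂ b₃ : ℤ) : Set (FreeGroup (Fin 4)) :=
  { (FreeGroup.of 3) * (FreeGroup.of 0) * (FreeGroup.of 3)⁻¹ * (FreeGroup.of 0)⁻¹,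
    (FreeGroup.of 3) * (FreeGroup.of 1) * (FreeGroup.of 3)⁻¹ * (FreeGroup.of 1)⁻¹,
    (FreeGroup.of 3) * (FreeGroup.of 2) * (FreeGroup.of 3)⁻¹ * (FreeGroup.of 2)⁻¹,
    (FreeGroup.of 0) ^ p * (FreeGroup.of 3) ^ b₁,
    (FreeGroup.of 1) ^ q * (FreeGroup.of 3) ^ b₂,
    (FreeGroup.of 2) ^ r * (FreeGroup.of 3) ^ b₃,
    (FreeGroup.of 0) * (FreeGroup.of 1) * (FreeGroup.of 2) * (FreeGroup.of 3) ^ b }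

/-- The group `G(p,q,r)`, i.e. the fundamental group of the Brieskorn homology
sphere `Σ(p,q,r)`, given by the presentation above. -/
def BrieskornGroup (p q r : ℕ) (b b₁ b₂ b₃ : ℤ) : Type :=
  PresentedGroup (brieskornRels p q r b b₁ b₂ b₃)

instance (p q r : ℕ) (b b₁ b₂ b₃ : ℤ) : Group (BrieskornGroup p q r b b₁ b₂ b₃) := by
  unfold BrieskornGroup; infer_instance

/-- The generator `x` of `G(p,q,r)`. -/
def xG {p q r : ℕ} {b b₁ b₂ b₃ : ℤ} : BrieskornGroup p q r b b₁ b₂ b₃ := PresentedGroup.of 0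
/-- The generator `y` of `G(p,q,r)`. -/
def yG {p q r : ℕ} {b b₁ b₂ b₃ : ℤ} : BrieskornGroup p q r b b₁ b₂ b₃ := PresentedGroup.of 1
/-- The generator `z` of `G(p,q,r)`. -/
def zG {p q r : ℕ} {b b₁ b₂ b₃ : ℤ} : BrieskornGroup p q r b b₁ b₂ b₃ := PresentedGroup.of 2
/-- The central generator `h` of `G(p,q,r)`. -/
def hG {p q r : ℕ} {b b₁ b₂ b₃ : ℤ} : BrieskornGroup p q r b b₁ b₂ b₃ := PresentedGroup.of 3

/-- A homomorphism to `Sp(1)` is irreducible if its image is nonabelian. -/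
def IsIrrep {Γ : Type*} [Group Γ] (α : Γ →* Sp1) : Prop :=
  ∃ s t : Γ, α s * α t ≠ α t * α s

namespace BrieskornGroup

variable {p q r : ℕ} {b b₁ b₂ b₃ : ℤ} {M : Type*} [Group M]

lemma commute_hG_xG : Commute (hG : BrieskornGroup p q r b b₁ b₂ b₃) xG := by
  have h : (PresentedGroup.mk (brieskornRels p q r b b₁ b₂ b₃)) (FreeGroup.of 3 *
      FreeGroup.of 0 * (FreeGroup.of 3)⁻¹ * (FreeGroup.of 0)⁻¹) = 1 :=
    PresentedGroup.one_of_mem (by simp [brieskornRels])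
  exact commutatorElement_eq_one_iff_commute.1 h

lemma commute_hG_yG : Commute (hG : BrieskornGroup p q r b b₁ b₂ b₃) yG := by
  have h : (PresentedGroup.mk (brieskornRels p q r b b₁ b₂ b₃)) (FreeGroup.of 3 *
      FreeGroup.of 1 * (FreeGroup.of 3)⁻¹ * (FreeGroup.of 1)⁻¹) = 1 :=
    PresentedGroup.one_of_mem (by simp [brieskornRels])
  exact commutatorElement_eq_one_iff_commute.1 h

lemma xG_mul_yG_mul_zG_mul_hG_zpow :
    (xG * yG * zG * hG ^ b : BrieskornGroup p q r b b₁ b₂ b₃) = 1 := by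
  have h : (PresentedGroup.mk (brieskornRels p q r b b₁ b₂ b₃)) (FreeGroup.of 0 *
      FreeGroup.of 1 * FreeGroup.of 2 * FreeGroup.of 3 ^ b) = 1 :=
    PresentedGroup.one_of_mem (by simp [brieskornRels])
  rw [map_mul, map_zpow] at h
  exact h

/-- A homomorphism out of `G(p,q,r)` is determined by its values on `x`, `y` and `h`. -/
lemma hom_ext {φ ψ : BrieskornGroup p q r b b₁ b₂ b₃ →* M}
    (hx : φ xG = ψ xG) (hy : φ yG = ψ yG) (hh : φ hG = ψ hG) : φ = ψ := by
  have hz : φ zG = ψ zG := by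
    have e₁ := congrArg φ (xG_mul_yG_mul_zG_mul_hG_zpow (p := p) (q := q) (r := r) (b := b)
      (b₁ := b₁) (b₂ := b₂) (b₃ := b₃))
    have e₂ := congrArg ψ (xG_mul_yG_mul_zG_mul_hG_zpow (p := p) (q := q) (r := r) (b := b)
      (b₁ := b₁) (b₂ := b₂) (b₃ := b₃))
    simp only [map_mul, map_zpow, map_one, hx, hy, hh] at e₁ e₂
    exact mul_left_cancel (mul_right_cancel (e₁.trans e₂.symm))
  refine PresentedGroup.ext fun i => ?_
  fin_cases i
  exacts [hx, hy, hz, hh]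

/-- An element intertwining two homomorphisms on `x`, `y` and `h` intertwines them everywhere. -/
lemma eq_conj {φ ψ : BrieskornGroup p q r b b₁ b₂ b₃ →* M} {c : M}
    (hx : ψ xG * c = c * φ xG) (hy : ψ yG * c = c * φ yG) (hh : ψ hG * c = c * φ hG)
    (t : BrieskornGroup p q r b b₁ b₂ b₃) : ψ t = c * φ t * c⁻¹ := by
  have h : ψ = (MulAut.conj c).toMonoidHom.comp φ :=
    hom_ext (eq_mul_inv_of_mul_eq hx) (eq_mul_inv_of_mul_eq hy) (eq_mul_inv_of_mul_eq hh)
  exact DFunLike.congr_fun h t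

/-- If the images of `x` and `y` commute, then the whole image is abelian. -/
lemma commute_map_of_commute {φ : BrieskornGroup p q r b b₁ b₂ b₃ →* M}
    (h : Commute (φ xG) (φ yG)) (s t : BrieskornGroup p q r b b₁ b₂ b₃) :
    Commute (φ s) (φ t) := by
  have key {g : M} (hx : Commute (φ xG) g) (hy : Commute (φ yG) g) (hh : Commute (φ hG) g)
      (t : BrieskornGroup p q r b b₁ b₂ b₃) : Commute (φ t) g :=
    eq_mul_inv_iff_mul_eq.1 (eq_conj hx hy hh t)
  have hhx := commute_hG_xG.map φ
  have hhy := commute_hG_yG.map φ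
  exact key (key (.refl _) h.symm hhx s).symm (key h (.refl _) hhy s).symm
    (key hhx.symm hhy.symm (.refl _) s).symm t |>.symm

end BrieskornGroup

lemma Complex.exists_mul_conj_eq_mul {w w' : ℂ} (h : ‖w‖ = ‖w'‖) :
    ∃ c : ℂ, ‖c‖ = 1 ∧ w' * starRingEnd ℂ c = c * w := by
  rcases eq_or_ne w 0 with rfl | hw
  · exact ⟨1, by simp, by simpa using h.symm⟩
  obtain ⟨c, hc⟩ := IsAlgClosed.exists_pow_nat_eq (w' / w) two_pos
  have hc1 : ‖c‖ = 1 := by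
    have : ‖c‖ ^ 2 = 1 := by
      rw [← norm_pow, hc, norm_div, ← h, div_self (norm_ne_zero_iff.2 hw)]
    exact (pow_eq_one_iff_of_nonneg (norm_nonneg c) two_ne_zero).1 this
  refine ⟨c, hc1, ?_⟩
  have hcc : c * starRingEnd ℂ c = 1 := by simp [Complex.mul_conj', hc1]
  rw [eq_div_iff hw] at hc
  linear_combination (-starRingEnd ℂ c) * hc + c * w * hcc

lemma Quaternion.norm_coeComplex_eq (c : ℂ) : ‖(c : ℍ[ℝ])‖ = ‖c‖ := by
  rw [← sq_eq_sq₀ (norm_nonneg _) (norm_nonneg _), sq, ← Quaternion.normSq_eq_norm_mul_self,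
    Quaternion.normSq_def', Complex.sq_norm, Complex.normSq_apply]
  simp [sq]

lemma Sp1.sum_sq (a : Sp1) : (a : ℍ[ℝ]).re ^ 2 + (a : ℍ[ℝ]).imI ^ 2 + (a : ℍ[ℝ]).imJ ^ 2 +
    (a : ℍ[ℝ]).imK ^ 2 = 1 := by
  rw [← Quaternion.normSq_def', Quaternion.normSq_eq_norm_mul_self, norm_eq_of_mem_sphere, one_mul]

/-- (Lemma 1 of the paper.) Let `α, β` be irreducible homomorphisms
`G(p,q,r) → Sp(1)` with `α(h) = β(h)`, `α(x) = β(x)` a complex quaternion,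
`Re α(y) = Re β(y)` and `Re (α(x)α(y)) = Re (β(x)β(y))`. Then `β = c·α·c⁻¹` for some
complex unit quaternion `c`. -/
theorem stmt_1 (p q r : ℕ) (hp : 2 ≤ p) (hq : 2 ≤ q) (hr : 2 ≤ r)
    (hpq : Nat.Coprime p q) (hqr : Nat.Coprime q r) (hpr : Nat.Coprime p r)
    (b b₁ b₂ b₃ : ℤ)
    (hsum : b₁ * q * r + b₂ * p * r + b₃ * p * q + b * p * q * r = 1)
    (α β : BrieskornGroup p q r b b₁ b₂ b₃ →* Sp1)
    (hα : IsIrrep α) (hβ : IsIrrep β)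
    (h1 : α hG = β hG) (h1' : α xG = β xG)
    (h1'' : ((α xG : ℍ[ℝ])).imJ = 0 ∧ ((α xG : ℍ[ℝ])).imK = 0)
    (h2 : ((α yG : ℍ[ℝ])).re = ((β yG : ℍ[ℝ])).re)
    (h3 : ((α xG : ℍ[ℝ]) * (α yG : ℍ[ℝ])).re = ((β xG : ℍ[ℝ]) * (β yG : ℍ[ℝ])).re) :
    ∃ c : Sp1, (c : ℍ[ℝ]).imJ = 0 ∧ (c : ℍ[ℝ]).imK = 0 ∧
      ∀ t, β t = c * α t * c⁻¹ := by
  obtain ⟨hJ, hK⟩ := h1''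
  have hI : (α xG : ℍ[ℝ]).imI ≠ 0 := by
    intro hI
    obtain ⟨s, t, hst⟩ := hα
    refine hst (BrieskornGroup.commute_map_of_commute (Subtype.ext ?_) s t)
    ext <;> simp [hI, hJ, hK, mul_comm]
  have hyI : (α yG : ℍ[ℝ]).imI = (β yG : ℍ[ℝ]).imI := by
    rw [← h1'] at h3
    simp only [Quaternion.re_mul, hJ, hK, h2] at h3
    exact mul_left_cancel₀ hI (by linarith)
  have hh : (α hG : ℍ[ℝ]).imJ = 0 ∧ (α hG : ℍ[ℝ]).imK = 0 := by
    have h : (α hG * α xG : ℍ[ℝ]) = α xG * α hG :=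
      congrArg Subtype.val (BrieskornGroup.commute_hG_xG.map α).eq
    have ej := congrArg QuaternionAlgebra.imJ h
    have ek := congrArg QuaternionAlgebra.imK h
    simp only [Quaternion.imJ_mul, Quaternion.imK_mul, hJ, hK] at ej ek
    exact ⟨mul_left_cancel₀ hI (by linarith), mul_left_cancel₀ hI (by linarith)⟩
  obtain ⟨hhJ, hhK⟩ := hh
  obtain ⟨c, hc, hcw⟩ := Complex.exists_mul_conj_eq_mul
    (w := ⟨(α yG : ℍ[ℝ]).imJ, (α yG : ℍ[ℝ]).imK⟩) (w' := ⟨(β yG : ℍ[ℝ]).imJ, (β yG : ℍ[ℝ]).imK⟩) <| by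
      have hα1 := Sp1.sum_sq (α yG)
      have hβ1 := Sp1.sum_sq (β yG)
      rw [h2, hyI] at hα1
      simp only [Complex.norm_def, Complex.normSq_mk]
      congr 1
      linarith
  have hre := congrArg Complex.re hcw
  have him := congrArg Complex.im hcw
  simp only [Complex.mul_re, Complex.mul_im, Complex.conj_re, Complex.conj_im] at hre him
  have hc' : (c : ℍ[ℝ]) ∈ Metric.sphere (0 : ℍ[ℝ]) 1 := by
    rw [mem_sphere_zero_iff_norm, Quaternion.norm_coeComplex_eq, hc]
  refine ⟨⟨c, hc'⟩, Quaternion.imJ_coeComplex c, Quaternion.imK_coeComplex c, BrieskornGroup.eq_conj ?_ ?_ ?_⟩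
  · rw [← h1']
    ext <;> simp [hJ, hK] <;> ring
  · ext <;> simp [← h2, ← hyI] <;> linarith
  · rw [← h1]
    ext <;> simp [hhJ, hhK] <;> ring
end

section
/- The set of conjugacy classes of irreducible homomorphisms from G(p,q,r) to Sp(1) is finite. -/
open Quaternion

section QuaternionConjugacy

theorem Quaternion.re_mul_comm (a b : ℍ[ℝ]) : (a * b).re = (b * a).re := by
  simp only [Quaternion.re_mul]; ring

theorem Quaternion.re_inv_mul_mul {c : ℍ[ℝ]} (hc : c ≠ 0) (a : ℍ[ℝ]) :
    (c⁻¹ * a * c).re = a.re := by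
  rw [Quaternion.re_mul_comm, ← mul_assoc, mul_inv_cancel₀ hc, one_mul]

theorem Quaternion.normSq_inv_mul_mul {c : ℍ[ℝ]} (hc : c ≠ 0) (a : ℍ[ℝ]) :
    normSq (c⁻¹ * a * c) = normSq a := by
  have : normSq c ≠ 0 := by simpa using hc
  simp only [map_mul, map_inv₀]
  field_simp

/-- Quaternions with the same real part and the same norm are conjugate. -/
theorem Quaternion.exists_mul_eq_mul {a b : ℍ[ℝ]} (hre : a.re = b.re)
    (hn : normSq a = normSq b) : ∃ c ≠ 0, c * a = b * c := by
  rw [normSq_def', normSq_def'] at hn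
  by_cases h : ∀ w : ℍ[ℝ], b.im * w + w * a.im = 0
  · have h1 := h 1
    obtain ⟨i, hi⟩ : ∃ i : ℍ[ℝ], i.re = 0 ∧ i.imI = 1 ∧ i.imJ = 0 ∧ i.imK = 0 :=
      ⟨⟨0, 1, 0, 0⟩, rfl, rfl, rfl, rfl⟩
    obtain ⟨j, hj⟩ : ∃ j : ℍ[ℝ], j.re = 0 ∧ j.imI = 0 ∧ j.imJ = 1 ∧ j.imK = 0 :=
      ⟨⟨0, 0, 1, 0⟩, rfl, rfl, rfl, rfl⟩
    have h2 := h i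
    have h3 := h j
    simp [Quaternion.ext_iff, hi, hj] at h1 h2 h3
    refine ⟨1, one_ne_zero, ?_⟩
    rw [one_mul, mul_one]
    ext <;> linarith
  · push Not at h
    obtain ⟨w, hw⟩ := h
    refine ⟨_, hw, ?_⟩
    have e : a.imI ^ 2 + a.imJ ^ 2 + a.imK ^ 2 = b.imI ^ 2 + b.imJ ^ 2 + b.imK ^ 2 := by
      rw [hre] at hn; linarith
    ext <;> simp [hre]
    · linear_combination (-w.re) * e
    · linear_combination (-w.imI) * e
    · linear_combination (-w.imJ) * e
    · linear_combination (-w.imK) * e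

theorem Quaternion.mul_eq_neg_mul_of_re_eq_zero {a b : ℍ[ℝ]} (ha : a.re = 0) (hb : b.re = 0)
    (hab : (a * b).re = 0) : a * b = -(b * a) := by
  simp [ha, hb] at hab
  ext <;> simp [ha, hb] <;> linarith

theorem Quaternion.exists_commute_mul_eq_mul {a b b' : ℍ[ℝ]} (hre : b.re = b'.re)
    (hn : normSq b = normSq b') (hab : (a * b).re = (a * b').re) (hne : a * b ≠ b * a) :
    ∃ c ≠ 0, c * a = a * c ∧ c * b = b' * c := by
  by_cases hb : b' = b
  · exact ⟨1, one_ne_zero, by simp, by simp [hb]⟩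
  set w := a * b - b * a with hw
  have hwre : w.re = 0 := by rw [hw, re_sub, re_mul_comm, sub_self]
  have hd : (b' - b).re = 0 := by simp [hre]
  have e1 : a.im * (b' - b) = -((b' - b) * a.im) := by
    refine mul_eq_neg_mul_of_re_eq_zero (by simp) hd ?_
    simp [hre] at hab ⊢
    linarith
  have e2 : a.im * w = -(w * a.im) := by
    refine mul_eq_neg_mul_of_re_eq_zero (by simp) hwre ?_
    simp [hw]; ring
  have e3 : b.im * w = -(w * b.im) := by
    refine mul_eq_neg_mul_of_re_eq_zero (by simp) hwre ?_
    simp [hw]; ring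
  have e4 : b.im * b.im = b'.im * b'.im := by
    rw [normSq_def', normSq_def', hre] at hn
    ext <;> simp <;> linarith
  have ra : a = (a.re : ℍ[ℝ]) + a.im := (re_add_im a).symm
  have rb : b = (b'.re : ℍ[ℝ]) + b.im := by rw [← hre, re_add_im]
  have rb' : b' = (b'.re : ℍ[ℝ]) + b'.im := (re_add_im b').symm
  have hdim : b' - b = b'.im - b.im := by
    ext <;> simp [hre]
  have c1 : (b' - b) * w * a.im = a.im * ((b' - b) * w) := by
    rw [← mul_assoc, e1, neg_mul, mul_assoc _ a.im, e2, mul_neg, neg_neg, mul_assoc]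
  have c2 : (b' - b) * w * b.im = b'.im * ((b' - b) * w) := by
    have : w * b.im = -(b.im * w) := by rw [e3, neg_neg]
    rw [mul_assoc, this, hdim, mul_neg, ← mul_assoc, ← mul_assoc, ← neg_mul, sub_mul _ _ b.im,
      mul_sub b'.im, e4, neg_sub]
  refine ⟨(b' - b) * w, mul_ne_zero (sub_ne_zero.2 hb) (sub_ne_zero.2 hne), ?_, ?_⟩
  · generalize (b' - b) * w = c at *
    rw [ra, mul_add, add_mul, c1, coe_commutes]
  · generalize (b' - b) * w = c at *
    rw [rb', rb, mul_add, add_mul, c2, coe_commutes]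

/-- A non-commuting pair `(a, b)` of quaternions is determined up to simultaneous conjugation by
the norms and real parts of `a`, `b` and the real part of `a * b`. -/
theorem Quaternion.exists_mul_eq_mul_pair {a b a' b' : ℍ[ℝ]} (hra : a.re = a'.re)
    (hna : normSq a = normSq a') (hrb : b.re = b'.re) (hnb : normSq b = normSq b')
    (hab : (a * b).re = (a' * b').re) (hne : a * b ≠ b * a) :
    ∃ c ≠ 0, c * a = a' * c ∧ c * b = b' * c := by
  obtain ⟨c, hc, hca⟩ := exists_mul_eq_mul hra hna
  have hac : a * c⁻¹ = c⁻¹ * a' := by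
    rw [mul_inv_eq_iff_eq_mul₀ hc, mul_assoc, ← hca, inv_mul_cancel_left₀ hc]
  obtain ⟨d, hd, hda, hdb⟩ := exists_commute_mul_eq_mul (a := a) (b := b) (b' := c⁻¹ * b' * c)
    (by rw [re_inv_mul_mul hc, hrb]) (by rw [normSq_inv_mul_mul hc, hnb])
    (by rw [← mul_assoc, ← mul_assoc, hac, mul_assoc c⁻¹, re_inv_mul_mul hc, hab]) hne
  refine ⟨c * d, mul_ne_zero hc hd, ?_, ?_⟩
  · rw [mul_assoc, hda, ← mul_assoc, hca, mul_assoc]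
  · rw [mul_assoc, hdb, ← mul_assoc, ← mul_assoc, ← mul_assoc, mul_inv_cancel₀ hc, one_mul,
      mul_assoc]

/-- A quaternion commuting with two non-commuting quaternions is real. -/
theorem Quaternion.im_eq_zero_of_commute {a b h : ℍ[ℝ]} (hne : a * b ≠ b * a)
    (ha : h * a = a * h) (hb : h * b = b * h) : h.im = 0 := by
  simp only [Quaternion.ext_iff, re_mul, imI_mul, imJ_mul, imK_mul] at ha hb
  obtain ⟨-, a1, a2, a3⟩ := ha
  obtain ⟨-, b1, b2, b3⟩ := hb
  by_contra hh
  apply hne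
  have key : ∀ x : ℝ, x = h.imI ∨ x = h.imJ ∨ x = h.imK → x ≠ 0 → a * b = b * a := by
    rintro x (rfl | rfl | rfl) hx <;> ext <;> simp only [re_mul, imI_mul, imJ_mul, imK_mul] <;>
      apply mul_left_cancel₀ hx <;> grind
  by_contra hab
  apply hh
  ext
  · simp
  · simpa using not_imp_comm.1 (key h.imI (by simp)) hab
  · simpa using not_imp_comm.1 (key h.imJ (by simp)) hab
  · simpa using not_imp_comm.1 (key h.imK (by simp)) hab

/-- Quaternionic `n`-th roots of unity have finitely many real parts. -/
theorem Quaternion.finite_re_rootsOfUnity {n : ℕ} (hn : n ≠ 0) :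
    {t : ℝ | ∃ a : ℍ[ℝ], a ^ n = 1 ∧ a.re = t}.Finite := by
  have hfin : {z : ℂ | z ^ n = 1}.Finite := by
    refine (Polynomial.nthRootsFinset n (1 : ℂ)).finite_toSet.subset fun z hz => ?_
    simpa [Polynomial.mem_nthRootsFinset (Nat.pos_of_ne_zero hn)] using hz
  refine (hfin.image Complex.re).subset ?_
  rintro t ⟨a, ha, rfl⟩
  have hs : 0 ≤ a.imI ^ 2 + a.imJ ^ 2 + a.imK ^ 2 := by positivity
  obtain ⟨c, hc, hca⟩ := exists_mul_eq_mul (a := a)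
    (b := ofComplex ⟨a.re, √(a.imI ^ 2 + a.imJ ^ 2 + a.imK ^ 2)⟩) (by simp)
    (by simp [normSq_def', Real.sq_sqrt hs]; ring)
  refine ⟨⟨a.re, √(a.imI ^ 2 + a.imJ ^ 2 + a.imK ^ 2)⟩, ?_, rfl⟩
  have hpow := SemiconjBy.pow_right (show SemiconjBy c a _ from hca) n
  rw [ha, ← map_pow] at hpow
  have h1 : ofComplex (⟨a.re, √(a.imI ^ 2 + a.imJ ^ 2 + a.imK ^ 2)⟩ ^ n) = 1 :=
    mul_right_cancel₀ hc (by rw [one_mul, ← hpow.eq, mul_one])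
  exact ofComplex.toRingHom.injective (h1.trans (map_one _).symm)

end QuaternionConjugacy

section UnitQuaternions

theorem Sp1.normSq_coe (a : Sp1) : normSq (a : ℍ[ℝ]) = 1 := by
  rw [normSq_eq_norm_mul_self, norm_eq_of_mem_sphere, one_mul]

theorem Sp1.exists_conj_pair {a b a' b' : Sp1} (ha : (a : ℍ[ℝ]).re = (a' : ℍ[ℝ]).re)
    (hb : (b : ℍ[ℝ]).re = (b' : ℍ[ℝ]).re)
    (hab : ((a * b : Sp1) : ℍ[ℝ]).re = ((a' * b' : Sp1) : ℍ[ℝ]).re) (hne : a * b ≠ b * a) :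
    ∃ c : Sp1, a' = c * a * c⁻¹ ∧ b' = c * b * c⁻¹ := by
  obtain ⟨c, hc, hca, hcb⟩ := exists_mul_eq_mul_pair ha (by simp only [normSq_coe]) hb
    (by simp only [normSq_coe]) hab (fun h => hne (Subtype.ext h))
  have hu : ‖c‖⁻¹ • c ∈ Metric.sphere (0 : ℍ[ℝ]) 1 := by
    simp [norm_smul, hc]
  refine ⟨⟨_, hu⟩, ?_, ?_⟩
  · rw [eq_mul_inv_iff_mul_eq]
    ext1
    simp [hca]
  · rw [eq_mul_inv_iff_mul_eq]
    ext1
    simp [hcb]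

theorem Sp1.eq_one_or_eq_neg_one_of_commute {a b h : Sp1} (hne : a * b ≠ b * a)
    (ha : h * a = a * h) (hb : h * b = b * h) : h = 1 ∨ h = -1 := by
  have him : (h : ℍ[ℝ]).im = 0 := im_eq_zero_of_commute (fun e => hne (Subtype.ext e))
    (congrArg Subtype.val ha) (congrArg Subtype.val hb)
  have hre := re_add_im (h : ℍ[ℝ])
  rw [him, add_zero] at hre
  have hn := normSq_coe h
  rw [← hre, Quaternion.normSq_coe, sq_eq_one_iff] at hn
  refine hn.imp (fun e => Subtype.ext ?_) (fun e => Subtype.ext ?_) <;> rw [← hre, e] <;> simp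

end UnitQuaternions

/-- A quotient is finite if some function with finite range separates unrelated elements. -/
theorem Quot.finite_of_finite_range {A B : Type*} {R : A → A → Prop} (f : A → B)
    (hf : (Set.range f).Finite) (hR : ∀ a a', f a = f a' → R a a') : Finite (Quot R) := by
  have := hf.to_subtype
  refine Finite.of_surjective (fun y : Set.range f => Quot.mk R y.2.choose) ?_
  rintro ⟨a⟩
  exact ⟨⟨f a, a, rfl⟩, Quot.sound (hR _ _ (Exists.choose_spec (⟨a, rfl⟩ : ∃ a', f a' = f a)))⟩

namespace BrieskornGroup

variable {p q r : ℕ} {b b₁ b₂ b₃ : ℤ}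

local notation "G" => BrieskornGroup p q r b b₁ b₂ b₃

theorem rel_eq_one {w : FreeGroup (Fin 4)} (hw : w ∈ brieskornRels p q r b b₁ b₂ b₃) :
    (PresentedGroup.mk (brieskornRels p q r b b₁ b₂ b₃) w : G) = 1 :=
  PresentedGroup.one_of_mem hw

theorem hG_mul_xG : (hG * xG : G) = xG * hG :=
  mul_inv_eq_iff_eq_mul.1 <| mul_inv_eq_one.1 <| rel_eq_one (b := b) (Or.inl rfl)

theorem hG_mul_yG : (hG * yG : G) = yG * hG :=
  mul_inv_eq_iff_eq_mul.1 <| mul_inv_eq_one.1 <| rel_eq_one (b := b) (by simp [brieskornRels])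

theorem hG_mul_zG : (hG * zG : G) = zG * hG :=
  mul_inv_eq_iff_eq_mul.1 <| mul_inv_eq_one.1 <| rel_eq_one (b := b) (by simp [brieskornRels])

theorem xG_pow : (xG ^ p * hG ^ b₁ : G) = 1 :=
  rel_eq_one (w := FreeGroup.of 0 ^ p * FreeGroup.of 3 ^ b₁) (by simp [brieskornRels])

theorem yG_pow : (yG ^ q * hG ^ b₂ : G) = 1 :=
  rel_eq_one (w := FreeGroup.of 1 ^ q * FreeGroup.of 3 ^ b₂) (by simp [brieskornRels])

theorem zG_pow : (zG ^ r * hG ^ b₃ : G) = 1 :=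
  rel_eq_one (w := FreeGroup.of 2 ^ r * FreeGroup.of 3 ^ b₃) (by simp [brieskornRels])

theorem xG_mul_yG_mul_zG : (xG * yG * zG * hG ^ b : G) = 1 :=
  rel_eq_one (w := FreeGroup.of 0 * FreeGroup.of 1 * FreeGroup.of 2 * FreeGroup.of 3 ^ b)
    (by simp [brieskornRels])

theorem zG_eq : (zG : G) = (xG * yG)⁻¹ * hG ^ (-b) := by
  rw [eq_inv_mul_iff_mul_eq, zpow_neg, eq_inv_iff_mul_eq_one]
  exact xG_mul_yG_mul_zG

/-- Homomorphisms agreeing on `x`, `y`, `h` are equal, as `z` is a word in these. -/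
theorem hom_ext_s2 {M : Type*} [Group M] {α β : G →* M} (hx : α xG = β xG) (hy : α yG = β yG)
    (hh : α hG = β hG) : α = β := by
  refine PresentedGroup.ext fun i => ?_
  fin_cases i
  · exact hx
  · exact hy
  · change α zG = β zG
    rw [zG_eq]
    simp only [map_mul, map_inv, map_zpow, hx, hy, hh]
  · exact hh

theorem map_commute {M : Type*} [Group M] {α : G →* M} {m : M} (hx : Commute m (α xG))
    (hy : Commute m (α yG)) (hh : Commute m (α hG)) (g : G) : Commute m (α g) := by
  have : (MulAut.conj m).toMonoidHom.comp α = α :=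
    hom_ext_s2 (by simp [hx.eq]) (by simp [hy.eq]) (by simp [hh.eq])
  exact mul_inv_eq_iff_eq_mul.1 (DFunLike.congr_fun this g)

theorem map_hG_commute {M : Type*} [Group M] (α : G →* M) (g : G) : Commute (α hG) (α g) :=
  Commute.map (map_commute (α := MonoidHom.id G) hG_mul_xG hG_mul_yG (Commute.refl _) g) α

theorem map_xG_mul_yG_ne {α : G →* Sp1} (hα : IsIrrep α) : α xG * α yG ≠ α yG * α xG := by
  intro h
  obtain ⟨s, t, hst⟩ := hα
  have hx := map_commute (α := α) (Commute.refl _) h (map_hG_commute α xG).symm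
  have hy := map_commute (α := α) (Commute.symm h) (Commute.refl _) (map_hG_commute α yG).symm
  exact hst (map_commute (hx s).symm (hy s).symm (map_hG_commute α s).symm t)

theorem map_hG {α : G →* Sp1} (hα : IsIrrep α) : α hG = 1 ∨ α hG = -1 :=
  Sp1.eq_one_or_eq_neg_one_of_commute (map_xG_mul_yG_ne hα) (map_hG_commute α _)
    (map_hG_commute α _)

theorem map_hG_sq {α : G →* Sp1} (hα : IsIrrep α) : α hG ^ 2 = 1 := by
  rcases map_hG hα with h | h <;> rw [h]
  exacts [one_pow 2, neg_one_sq]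

theorem pow_two_mul_eq_one {M : Type*} [Group M] {a h : M} {n : ℕ} {k : ℤ} (hh : h ^ 2 = 1)
    (ha : a ^ n * h ^ k = 1) : a ^ (2 * n) = 1 := by
  rw [mul_comm, pow_mul, eq_inv_of_mul_eq_one_left ha, inv_pow, ← zpow_natCast, zpow_comm,
    zpow_natCast, hh, one_zpow, inv_one]

theorem map_xG_mul_yG_pow {α : G →* Sp1} (hα : IsIrrep α) :
    (α xG * α yG) ^ (2 * r) = 1 := by
  have hz : α zG ^ (2 * r) = 1 :=
    pow_two_mul_eq_one (map_hG_sq hα) (by simpa using congrArg α (zG_pow (r := r)))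
  have e : α xG * α yG = (α zG * α hG ^ b)⁻¹ := by
    rw [eq_inv_iff_mul_eq_one, ← mul_assoc]
    simpa using congrArg α xG_mul_yG_mul_zG
  have hc : Commute (α zG) (α hG ^ b) := ((map_hG_commute α zG).symm).zpow_right b
  rw [e, inv_pow, hc.mul_pow, hz, one_mul, ← zpow_natCast, zpow_comm, zpow_natCast, pow_mul,
    map_hG_sq hα, one_pow, one_zpow, inv_one]

/-- The image of `h` and the real parts of the images of `x`, `y` and `x * y`. -/
noncomputable def invariants (α : G →* Sp1) : Sp1 × ℝ × ℝ × ℝ :=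
  (α hG, (α xG : ℍ[ℝ]).re, (α yG : ℍ[ℝ]).re, ((α xG * α yG : Sp1) : ℍ[ℝ]).re)

theorem finite_range_invariants (hp : p ≠ 0) (hq : q ≠ 0) (hr : r ≠ 0) :
    (Set.range fun α : {f : G →* Sp1 // IsIrrep f} => invariants α.1).Finite := by
  refine (Set.Finite.prod (Set.toFinite {1, -1}) <|
    (finite_re_rootsOfUnity (n := 2 * p) (by simpa)).prod <|
    (finite_re_rootsOfUnity (n := 2 * q) (by simpa)).prod <|
    finite_re_rootsOfUnity (n := 2 * r) (by simpa)).subset ?_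
  rintro _ ⟨⟨α, hα⟩, rfl⟩
  refine ⟨map_hG hα, ⟨α xG, congrArg Subtype.val (a₁ := α xG ^ (2 * p)) (a₂ := 1) ?_, rfl⟩,
    ⟨α yG, congrArg Subtype.val (a₁ := α yG ^ (2 * q)) (a₂ := 1) ?_, rfl⟩,
    ⟨_, congrArg Subtype.val (map_xG_mul_yG_pow hα), rfl⟩⟩
  · exact pow_two_mul_eq_one (map_hG_sq hα) (by simpa using congrArg α xG_pow)
  · exact pow_two_mul_eq_one (map_hG_sq hα) (by simpa using congrArg α yG_pow)

theorem exists_conj_of_invariants_eq {α β : G →* Sp1} (hα : IsIrrep α)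
    (h : invariants α = invariants β) : ∃ c : Sp1, ∀ t, β t = c * α t * c⁻¹ := by
  simp only [invariants, Prod.mk.injEq] at h
  obtain ⟨hh, hx, hy, hxy⟩ := h
  obtain ⟨c, hcx, hcy⟩ := Sp1.exists_conj_pair hx hy hxy (map_xG_mul_yG_ne hα)
  have : β = (MulAut.conj c).toMonoidHom.comp α := by
    refine hom_ext_s2 hcx hcy ?_
    rw [← hh]
    change α hG = c * α hG * c⁻¹
    rw [eq_mul_inv_iff_mul_eq]
    rcases map_hG hα with e | e <;> rw [e]
    exacts [(Commute.one_left c).eq, (Commute.neg_one_left c).eq]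
  exact ⟨c, fun t => DFunLike.congr_fun this t⟩

end BrieskornGroup

/-- The set of conjugacy classes of irreducible homomorphisms
`G(p,q,r) → Sp(1)` is finite. -/
theorem stmt_2 (p q r : ℕ) (hp : 2 ≤ p) (hq : 2 ≤ q) (hr : 2 ≤ r)
    (hpq : Nat.Coprime p q) (hqr : Nat.Coprime q r) (hpr : Nat.Coprime p r)
    (b b₁ b₂ b₃ : ℤ)
    (hsum : b₁ * q * r + b₂ * p * r + b₃ * p * q + b * p * q * r = 1) :
    Finite (Quot (fun (α β : {f : BrieskornGroup p q r b b₁ b₂ b₃ →* Sp1 // IsIrrep f}) =>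
      ∃ c : Sp1, ∀ t, β.1 t = c * α.1 t * c⁻¹)) :=
  Quot.finite_of_finite_range _
    (BrieskornGroup.finite_range_invariants (by lia) (by lia) (by lia))
    fun α _ h => BrieskornGroup.exists_conj_of_invariants_eq α.2 h
end

section
/- Let ρ ∈ Sp(1) satisfy ρ² = -1. Then the set S^ρ = { a ∈ Sp(1) : a⁻¹ = ρ·a·ρ⁻¹ } is homeomorphic to the 2-sphere S². -/
open Quaternion

theorem inv_eq_conj_iff_mul_sq_eq_neg_one {G : Type*} [Group G] [HasDistribNeg G] {ρ : G}
    (hρ : ρ ^ 2 = -1) (a : G) : a⁻¹ = ρ * a * ρ⁻¹ ↔ (ρ * a) ^ 2 = -1 := by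
  have hinv : ρ⁻¹ = -ρ := by
    rw [inv_eq_iff_mul_eq_one, mul_neg, ← sq, hρ, neg_neg]
  rw [hinv, eq_comm, eq_inv_iff_mul_eq_one, sq]
  simp only [mul_neg, neg_mul, mul_assoc, neg_eq_iff_eq_neg]

theorem Quaternion.sq_eq_neg_one_iff_re_eq_zero {q : ℍ[ℝ]} (hq : ‖q‖ = 1) :
    q ^ 2 = -1 ↔ q.re = 0 := by
  have hn : normSq q = 1 := by rw [normSq_eq_norm_mul_self, hq, mul_one]
  rw [normSq_def'] at hn
  constructor
  · intro h
    have h0 := congrArg QuaternionAlgebra.re h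
    simp only [sq, re_mul, re_neg, re_one] at h0
    nlinarith
  · intro h
    rw [sq_eq_neg_normSq.2 h, normSq_def', hn]
    simp

/-- The unit quaternions squaring to `-1` form the unit sphere of the imaginary quaternions. -/
noncomputable def sqrtNegOneHomeomorphSphere :
    {b : Sp1 // b ^ 2 = -1} ≃ₜ Metric.sphere (0 : EuclideanSpace ℝ (Fin 3)) 1 where
  toFun b := ⟨!₂[(b : ℍ[ℝ]).imI, (b : ℍ[ℝ]).imJ, (b : ℍ[ℝ]).imK], by
    obtain ⟨⟨b, hb⟩, h⟩ := b
    have hb' : ‖b‖ = 1 := mem_sphere_zero_iff_norm.1 hb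
    have h0 := (Quaternion.sq_eq_neg_one_iff_re_eq_zero hb').1 (congrArg Subtype.val h)
    have hn : normSq b = 1 := by rw [normSq_eq_norm_mul_self, hb', mul_one]
    rw [normSq_def', h0] at hn
    simp [EuclideanSpace.norm_eq, Fin.sum_univ_three]
    linarith⟩
  invFun x :=
    let q : ℍ[ℝ] := ⟨0, x.1 0, x.1 1, x.1 2⟩
    have hx : ‖q‖ = 1 := by
      have h := mem_sphere_zero_iff_norm.1 x.2
      rw [← sq_eq_sq₀ (norm_nonneg _) zero_le_one, EuclideanSpace.real_norm_sq_eq,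
        Fin.sum_univ_three] at h
      rw [← sq_eq_sq₀ (norm_nonneg _) zero_le_one, sq, ← normSq_eq_norm_mul_self, normSq_def']
      simpa [q] using h
    ⟨⟨q, mem_sphere_zero_iff_norm.2 hx⟩,
      Subtype.ext ((Quaternion.sq_eq_neg_one_iff_re_eq_zero hx).2 rfl)⟩
  left_inv b := by
    obtain ⟨⟨b, hb⟩, h⟩ := b
    have h0 := (Quaternion.sq_eq_neg_one_iff_re_eq_zero
      (mem_sphere_zero_iff_norm.1 hb)).1 (congrArg Subtype.val h)
    ext <;> simp [h0]
  right_inv x := by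
    ext i
    fin_cases i <;> rfl
  continuous_toFun := by
    have hb : Continuous fun b : {b : Sp1 // b ^ 2 = -1} ↦ (b : ℍ[ℝ]) :=
      continuous_subtype_val.comp continuous_subtype_val
    refine Continuous.subtype_mk ((PiLp.continuous_toLp 2 _).comp (continuous_pi fun i ↦ ?_)) _
    fin_cases i
    · exact continuous_imI.comp hb
    · exact continuous_imJ.comp hb
    · exact continuous_imK.comp hb
  continuous_invFun := by
    refine Continuous.subtype_mk (Continuous.subtype_mk ?_ _) _
    refine linearIsometryEquivTuple.symm.continuous.comp
      ((PiLp.continuous_toLp 2 _).comp (continuous_pi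
        (f := fun x : Metric.sphere (0 : EuclideanSpace ℝ (Fin 3)) 1 ↦
          ![0, x.1 0, x.1 1, x.1 2]) fun i ↦ ?_))
    fin_cases i <;> simp <;> fun_prop


/-- For `ρ ∈ Sp(1)` with `ρ² = -1`, the set
`S^ρ = { a ∈ Sp(1) : a⁻¹ = ρ·a·ρ⁻¹ }` is homeomorphic to the 2-sphere `S²`. -/
theorem stmt_6 (ρ : Sp1) (hρ : ρ ^ 2 = -1) :
    Nonempty ({a : Sp1 // a⁻¹ = ρ * a * ρ⁻¹} ≃ₜ
      Metric.sphere (0 : EuclideanSpace ℝ (Fin 3)) 1) := by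
  have hiff := inv_eq_conj_iff_mul_sq_eq_neg_one (G := Sp1) hρ
  exact ⟨(Homeomorph.subtype (Homeomorph.mulLeft (G := Sp1) ρ) hiff).trans
    sqrtNegOneHomeomorphSphere⟩
end

section
/- Let p ≥ 2 be an integer and let a ∈ Sp(1) with a ≠ 1 and a ≠ -1. If a^p = 1, then Re a = cos(πℓ/p) for some even integer ℓ with 0 < ℓ < p; if a^p = -1, then Re a = cos(πℓ/p) for some odd integer ℓ with 0 < ℓ < p. -/
open Quaternion

theorem Quaternion.sq_sum_eq_one_of_norm_eq_one {a : ℍ[ℝ]} (ha : ‖a‖ = 1) :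
    a.re ^ 2 + a.imI ^ 2 + a.imJ ^ 2 + a.imK ^ 2 = 1 := by
  rw [← Quaternion.normSq_def', Quaternion.normSq_eq_norm_mul_self, ha, mul_one]

theorem Quaternion.mul_self_eq_of_norm_eq_one {a : ℍ[ℝ]} (ha : ‖a‖ = 1) :
    a * a = (2 * a.re) • a - 1 := by
  have h := Quaternion.sq_sum_eq_one_of_norm_eq_one ha
  ext <;> simp <;> linarith

theorem Quaternion.re_pow_eq_cos {a : ℍ[ℝ]} (ha : ‖a‖ = 1) {θ : ℝ}
    (hθ : a.re = Real.cos θ) (n : ℕ) : (a ^ n).re = Real.cos (n * θ) := by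
  induction n using Nat.twoStepInduction with
  | zero => simp
  | one => simpa using hθ
  | more n ih₀ ih₁ =>
    have h : a ^ (n + 2) = (2 * a.re) • a ^ (n + 1) - a ^ n := by
      rw [pow_add, sq, Quaternion.mul_self_eq_of_norm_eq_one ha, mul_sub, mul_one,
        mul_smul_comm, ← pow_succ]
    have e₀ : (n : ℝ) * θ = (n + 1 : ℕ) * θ - θ := by push_cast; ring
    have e₂ : ((n + 2 : ℕ) : ℝ) * θ = (n + 1 : ℕ) * θ + θ := by push_cast; ring
    rw [h, Quaternion.re_sub, Quaternion.re_smul, ih₀, ih₁, hθ, e₀, e₂, Real.cos_sub,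
      Real.cos_add, smul_eq_mul]
    ring

theorem Quaternion.abs_re_lt_one {a : ℍ[ℝ]} (ha : ‖a‖ = 1) (ha1 : a ≠ 1) (ha2 : a ≠ -1) :
    |a.re| < 1 := by
  have h := Quaternion.sq_sum_eq_one_of_norm_eq_one ha
  rw [← sq_lt_one_iff_abs_lt_one]
  by_contra! hr
  have hI : a.imI = 0 := by nlinarith [sq_nonneg a.imI, sq_nonneg a.imJ, sq_nonneg a.imK]
  have hJ : a.imJ = 0 := by nlinarith [sq_nonneg a.imI, sq_nonneg a.imJ, sq_nonneg a.imK]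
  have hK : a.imK = 0 := by nlinarith [sq_nonneg a.imI, sq_nonneg a.imJ, sq_nonneg a.imK]
  have hre : a.re ^ 2 = 1 := by simpa [hI, hJ, hK] using h
  rcases sq_eq_one_iff.mp hre with h1 | h1
  · exact ha1 (by ext <;> simp [*])
  · exact ha2 (by ext <;> simp [*])

theorem Real.bounds_of_mul_eq_pi_mul {θ : ℝ} (h0 : 0 < θ) (hπ : θ < Real.pi) {p : ℕ}
    (hp : 0 < p) {l : ℤ} (h : p * θ = Real.pi * l) :
    0 < l ∧ l < (p : ℤ) ∧ θ = Real.pi * l / p := by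
  have hp' : (0 : ℝ) < p := by exact_mod_cast hp
  refine ⟨?_, ?_, ?_⟩
  · have : 0 < Real.pi * (l : ℝ) := h ▸ mul_pos hp' h0
    exact_mod_cast (pos_iff_pos_of_mul_pos this).mp Real.pi_pos
  · have : Real.pi * (l : ℝ) < Real.pi * p := by
      rw [← h, mul_comm Real.pi]
      exact mul_lt_mul_of_pos_left hπ hp'
    exact_mod_cast lt_of_mul_lt_mul_left this Real.pi_pos.le
  · rw [← h]
    field_simp

/-- Let `p ≥ 2` and let `a` be a unit quaternion with `a ≠ ±1`.
If `a^p = 1` then `Re a = cos(πℓ/p)` for some even integer `0 < ℓ < p`; if `a^p = -1`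
then `Re a = cos(πℓ/p)` for some odd integer `0 < ℓ < p`. -/
theorem stmt_11 (p : ℕ) (hp : 2 ≤ p) (a : ℍ[ℝ]) (ha : ‖a‖ = 1)
    (ha1 : a ≠ 1) (ha2 : a ≠ -1) :
    (a ^ p = 1 → ∃ ℓ : ℤ, Even ℓ ∧ 0 < ℓ ∧ ℓ < (p : ℤ) ∧
      a.re = Real.cos (Real.pi * ℓ / p)) ∧
    (a ^ p = -1 → ∃ ℓ : ℤ, Odd ℓ ∧ 0 < ℓ ∧ ℓ < (p : ℤ) ∧
      a.re = Real.cos (Real.pi * ℓ / p)) := by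
  obtain ⟨hlo, hhi⟩ := abs_lt.mp (Quaternion.abs_re_lt_one ha ha1 ha2)
  obtain ⟨θ, h0, hπ, hθ⟩ : ∃ θ : ℝ, 0 < θ ∧ θ < Real.pi ∧ a.re = Real.cos θ := by
    refine ⟨Real.arccos a.re, Real.arccos_pos.mpr hhi, ?_,
      (Real.cos_arccos hlo.le hhi.le).symm⟩
    exact (Real.arccos_le_pi _).lt_of_ne fun h => hlo.not_ge (Real.arccos_eq_pi.mp h)
  have hre := Quaternion.re_pow_eq_cos ha hθ p
  have hp0 : 0 < p := by lia
  constructor <;> intro hpow <;> rw [hpow] at hre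
  · obtain ⟨k, hk⟩ := (Real.cos_eq_one_iff _).mp (hre.symm.trans Quaternion.re_one)
    obtain ⟨h1, h2, h3⟩ := Real.bounds_of_mul_eq_pi_mul h0 hπ hp0 (l := 2 * k)
      (by rw [← hk]; push_cast; ring)
    exact ⟨2 * k, even_two_mul k, h1, h2, h3 ▸ hθ⟩
  · obtain ⟨k, hk⟩ := (Real.cos_eq_one_iff (p * θ - Real.pi)).mp
      (by rw [Real.cos_sub_pi, ← hre]; simp)
    obtain ⟨h1, h2, h3⟩ := Real.bounds_of_mul_eq_pi_mul h0 hπ hp0 (l := 2 * k + 1)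
      (by push_cast; linarith)
    exact ⟨2 * k + 1, odd_two_mul_add_one k, h1, h2, h3 ▸ hθ⟩
end
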